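/- arXiv:math/0702444 — 3 statements merged into one kernel-verified Lean document; each statement's English description precedes it below -/
import Mathlib

section
/- Let K be a field of characteristic zero and R = K[x_1, ..., x_n] the polynomial ring. For every positive integer a, the power sums p_a, p_{a+1}, ..., p_{a+n−1} form a regular sequence in R; equivalently, the ideal I = (p_a, p_{a+1}, ..., p_{a+n−1}) is a complete intersection and R/I is Artinian. -/
set_option maxHeartbeats 1000000
set_option synthInstance.maxHeartbeats 400000

open TensorProduct

section LefschetzPrelude

variable (K : Type) [Field K]

/-- `𝒜` makes `A` into a graded Artinian `K`-algebra (with possibly non-standard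
grading): `A` is the internal direct sum of the `𝒜 i`, the grading is
multiplicative, `A₀ = K·1` and `A` is finite dimensional over `K`. -/
def IsGradedArtinAlg {A : Type} [CommRing A] [Algebra K A]
    (𝒜 : ℕ → Submodule K A) : Prop :=
  DirectSum.IsInternal 𝒜 ∧
  (1 : A) ∈ 𝒜 0 ∧
  (∀ i j : ℕ, ∀ x ∈ 𝒜 i, ∀ y ∈ 𝒜 j, x * y ∈ 𝒜 (i + j)) ∧
  𝒜 0 = Submodule.span K {(1 : A)} ∧
  FiniteDimensional K A

/-- `c` is the top degree of the grading `𝒜`. -/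
def GradedTop {A : Type} [CommRing A] [Algebra K A]
    (𝒜 : ℕ → Submodule K A) (c : ℕ) : Prop :=
  𝒜 c ≠ ⊥ ∧ ∀ i : ℕ, c < i → 𝒜 i = ⊥

/-- `ℳ` makes the `A`-module `V` into a finite graded module over the graded
algebra `(A, 𝒜)`. -/
def IsGradedMod {A V : Type} [CommRing A] [Algebra K A] [AddCommGroup V]
    [Module K V] [Module A V] [IsScalarTower K A V]
    (𝒜 : ℕ → Submodule K A) (ℳ : ℤ → Submodule K V) : Prop :=
  DirectSum.IsInternal ℳ ∧
  (∀ (i : ℕ) (j : ℤ), ∀ a ∈ 𝒜 i, ∀ v ∈ ℳ j, a • v ∈ ℳ (j + i)) ∧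
  FiniteDimensional K V

/-- The graded pieces of `ℳ` are supported exactly between degrees `a` and `b`. -/
def GradedBetween {V : Type} [AddCommGroup V] [Module K V]
    (ℳ : ℤ → Submodule K V) (a b : ℤ) : Prop :=
  a ≤ b ∧ ℳ a ≠ ⊥ ∧ ℳ b ≠ ⊥ ∧ ∀ i : ℤ, i < a ∨ b < i → ℳ i = ⊥

/-- Multiplication by `g : A` on the `A`-module `V`, as a `K`-linear endomorphism. -/
noncomputable def mulMap {A : Type} (V : Type) [CommRing A] [Algebra K A] [AddCommGroup V]
    [Module K V] [Module A V] [IsScalarTower K A V] (g : A) : Module.End K V :=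
  (LinearMap.lsmul A V g).restrictScalars K

/-- The endomorphism `f` of the graded vector space `ℳ` (supported between
degrees `a` and `b`) is a weak Lefschetz operator: each `f : ℳ i → ℳ (i+1)` is
injective or surjective. -/
def IsWLEndo {V : Type} [AddCommGroup V] [Module K V]
    (ℳ : ℤ → Submodule K V) (a b : ℤ) (f : Module.End K V) : Prop :=
  ∀ i : ℤ, a ≤ i → i + 1 ≤ b →
    ((∀ v ∈ ℳ i, f v = 0 → v = 0) ∨ (∀ w ∈ ℳ (i + 1), ∃ v ∈ ℳ i, f v = w))

/-- The endomorphism `f` of the graded vector space `ℳ` (supported between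
degrees `a` and `b`) is a strong Lefschetz operator:
`f^(b-a-2i) : ℳ (a+i) → ℳ (b-i)` is bijective for all `0 ≤ 2i ≤ b-a`. -/
def IsSLEndo {V : Type} [AddCommGroup V] [Module K V]
    (ℳ : ℤ → Submodule K V) (a b : ℤ) (f : Module.End K V) : Prop :=
  ∀ i : ℕ, 2 * (i : ℤ) ≤ b - a →
    (∀ v ∈ ℳ (a + i), (f ^ (b - a - 2 * i).toNat) v = 0 → v = 0) ∧
    (∀ w ∈ ℳ (b - i), ∃ v ∈ ℳ (a + i), (f ^ (b - a - 2 * i).toNat) v = w)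

/-- `g ∈ A₁` is a weak Lefschetz element for the graded module `(V, ℳ)`. -/
def IsWLElem {A V : Type} [CommRing A] [Algebra K A] [AddCommGroup V]
    [Module K V] [Module A V] [IsScalarTower K A V]
    (𝒜 : ℕ → Submodule K A) (ℳ : ℤ → Submodule K V) (a b : ℤ) (g : A) : Prop :=
  g ∈ 𝒜 1 ∧ IsWLEndo K ℳ a b (mulMap K V g)

/-- `g ∈ A₁` is a strong Lefschetz element for the graded module `(V, ℳ)`. -/
def IsSLElem {A V : Type} [CommRing A] [Algebra K A] [AddCommGroup V]
    [Module K V] [Module A V] [IsScalarTower K A V]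
    (𝒜 : ℕ → Submodule K A) (ℳ : ℤ → Submodule K V) (a b : ℤ) (g : A) : Prop :=
  g ∈ 𝒜 1 ∧ IsSLEndo K ℳ a b (mulMap K V g)

/-- The Hilbert function of the graded vector space `ℳ`. -/
noncomputable def hilb {V : Type} [AddCommGroup V] [Module K V]
    (ℳ : ℤ → Submodule K V) (i : ℤ) : ℕ :=
  Module.finrank K (ℳ i)

/-- The Hilbert function of `ℳ`, supported between `a` and `b`, is symmetric. -/
def SymHilb {V : Type} [AddCommGroup V] [Module K V]
    (ℳ : ℤ → Submodule K V) (a b : ℤ) : Prop :=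
  ∀ i : ℤ, hilb K ℳ (a + i) = hilb K ℳ (b - i)

/-- The Hilbert function of `ℳ`, supported between `a` and `b`, is unimodal. -/
def UnimodalHilb {V : Type} [AddCommGroup V] [Module K V]
    (ℳ : ℤ → Submodule K V) (a b : ℤ) : Prop :=
  ∃ m : ℤ, a ≤ m ∧ m ≤ b ∧
    (∀ i j : ℤ, a ≤ i → i ≤ j → j ≤ m → hilb K ℳ i ≤ hilb K ℳ j) ∧
    (∀ i j : ℤ, m ≤ i → i ≤ j → j ≤ b → hilb K ℳ j ≤ hilb K ℳ i)

/-- The Sperner number of `ℳ` (supported between `a` and `b`). -/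
noncomputable def sperner {V : Type} [AddCommGroup V] [Module K V]
    (ℳ : ℤ → Submodule K V) (a b : ℤ) : ℕ :=
  (Finset.Icc a b).sup fun i => hilb K ℳ i

/-- The CoSperner number of `ℳ` (supported between `a` and `b`). -/
noncomputable def coSperner {V : Type} [AddCommGroup V] [Module K V]
    (ℳ : ℤ → Submodule K V) (a b : ℤ) : ℕ :=
  ∑ i ∈ Finset.Icc a (b - 1), min (hilb K ℳ i) (hilb K ℳ (i + 1))

/-- `SP_k(V) = Σ_{i=a}^{b} max (dim V_i - dim V_{i-k}) 0` (via truncated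
subtraction on `ℕ`). -/
noncomputable def spernerVec {V : Type} [AddCommGroup V] [Module K V]
    (ℳ : ℤ → Submodule K V) (a b : ℤ) (k : ℕ) : ℕ :=
  ∑ i ∈ Finset.Icc a b, (hilb K ℳ i - hilb K ℳ (i - (k : ℤ)))

/-- `d` is the multiset of Jordan block sizes of the (nilpotent) endomorphism `f`:
all entries are positive and `dim ker f^k = Σ_{n ∈ d} min n k` for every `k`. -/
def IsJordanType {V : Type} [AddCommGroup V] [Module K V]
    (f : Module.End K V) (d : Multiset ℕ) : Prop :=
  (∀ n ∈ d, 0 < n) ∧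
  ∀ k : ℕ, Module.finrank K (LinearMap.ker (f ^ k)) = (d.map fun n => min n k).sum

/-- `g ∈ A₁` is a weak Lefschetz element of the graded algebra `(A, 𝒜)` with top
degree `c`. -/
def IsAlgWLElem {A : Type} [CommRing A] [Algebra K A]
    (𝒜 : ℕ → Submodule K A) (c : ℕ) (g : A) : Prop :=
  g ∈ 𝒜 1 ∧ ∀ i : ℕ, i + 1 ≤ c →
    ((∀ v ∈ 𝒜 i, g * v = 0 → v = 0) ∨ (∀ w ∈ 𝒜 (i + 1), ∃ v ∈ 𝒜 i, g * v = w))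

/-- `g ∈ A₁` is a strong Lefschetz element of the graded algebra `(A, 𝒜)` with top
degree `c`: `×g^(c-2i) : A_i → A_{c-i}` is bijective for `0 ≤ 2i ≤ c`. -/
def IsAlgSLElem {A : Type} [CommRing A] [Algebra K A]
    (𝒜 : ℕ → Submodule K A) (c : ℕ) (g : A) : Prop :=
  g ∈ 𝒜 1 ∧ ∀ i : ℕ, 2 * i ≤ c →
    (∀ v ∈ 𝒜 i, g ^ (c - 2 * i) * v = 0 → v = 0) ∧
    (∀ w ∈ 𝒜 (c - i), ∃ v ∈ 𝒜 i, g ^ (c - 2 * i) * v = w)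

/-- The graded algebra `(A, 𝒜)` has the weak Lefschetz property. -/
def AlgHasWLP {A : Type} [CommRing A] [Algebra K A] (𝒜 : ℕ → Submodule K A) : Prop :=
  ∃ c : ℕ, GradedTop K 𝒜 c ∧ ∃ g : A, IsAlgWLElem K 𝒜 c g

/-- The graded algebra `(A, 𝒜)` has the strong Lefschetz property. -/
def AlgHasSLP {A : Type} [CommRing A] [Algebra K A] (𝒜 : ℕ → Submodule K A) : Prop :=
  ∃ c : ℕ, GradedTop K 𝒜 c ∧ ∃ g : A, IsAlgSLElem K 𝒜 c g

/-- The graded pieces of the tensor product `V ⊗[K] W` of two graded vector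
spaces: `(ℳ ⊗ 𝒩)_k = Σ_{i+j=k} ℳ_i ⊗ 𝒩_j`. -/
noncomputable def tensorGrading {V W : Type} [AddCommGroup V] [Module K V]
    [AddCommGroup W] [Module K W] (ℳ : ℤ → Submodule K V) (𝒩 : ℤ → Submodule K W)
    (k : ℤ) : Submodule K (V ⊗[K] W) :=
  ⨆ i : ℤ, LinearMap.range (TensorProduct.map (ℳ i).subtype (𝒩 (k - i)).subtype)

/-- Reindex a `ℕ`-indexed grading by `ℤ`. -/
noncomputable def natToZ {V : Type} [AddCommGroup V] [Module K V]
    (ℒ : ℕ → Submodule K V) (i : ℤ) : Submodule K V :=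
  if 0 ≤ i then ℒ i.toNat else ⊥

/-- The truncated polynomial ring `K[t]/(t^α)`. -/
abbrev TruncPoly (α : ℕ) : Type :=
  Polynomial K ⧸ Ideal.span {(Polynomial.X : Polynomial K) ^ α}

/-- The image of `t` in `K[t]/(t^α)`. -/
noncomputable def tbar (α : ℕ) : TruncPoly K α :=
  Ideal.Quotient.mk _ Polynomial.X

/-- The standard grading of `K[t]/(t^α)` (with `deg t = 1`): the degree-`j` piece
is spanned by the class of `t^j` for `0 ≤ j < α`, and is zero otherwise. -/
noncomputable def truncGrading (α : ℕ) (j : ℤ) : Submodule K (TruncPoly K α) :=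
  if 0 ≤ j ∧ j < (α : ℤ) then Submodule.span K {tbar K α ^ j.toNat} else ⊥

end LefschetzPrelude

section PolyPrelude

variable (K : Type) [Field K] (n : ℕ)

/-- The subring `S = K[e₁, …, e_n]` of symmetric polynomials of
`R = K[x₁, …, x_n]`. -/
noncomputable def symS : Subalgebra K (MvPolynomial (Fin n) K) :=
  MvPolynomial.symmetricSubalgebra (Fin n) K

theorem mem_symS (p : MvPolynomial (Fin n) K) :
    p ∈ symS K n ↔ p.IsSymmetric :=
  MvPolynomial.mem_symmetricSubalgebra p

/-- The power sum `p_d = x₁^d + ⋯ + x_n^d`, as an element of `S`. -/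
noncomputable def psumS (d : ℕ) : ↥(symS K n) :=
  ⟨MvPolynomial.psum (Fin n) K d,
    (mem_symS K n _).mpr (MvPolynomial.psum_isSymmetric _ _ d)⟩

/-- The elementary symmetric polynomial `e_k`, as an element of `S`. -/
noncomputable def esymmS (k : ℕ) : ↥(symS K n) :=
  ⟨MvPolynomial.esymm (Fin n) K k,
    (mem_symS K n _).mpr (MvPolynomial.esymm_isSymmetric _ _ k)⟩

/-- The standard grading on a quotient `R/I` of the polynomial ring
`R = K[x₁, …, x_n]`: the degree-`d` piece is the image of the space of
homogeneous polynomials of degree `d`. -/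
noncomputable def quotGrading (I : Ideal (MvPolynomial (Fin n) K)) (d : ℕ) :
    Submodule K (MvPolynomial (Fin n) K ⧸ I) :=
  Submodule.map (Ideal.Quotient.mkₐ K I).toLinearMap
    (MvPolynomial.homogeneousSubmodule (Fin n) K d)

/-- The (non-standard) grading on a quotient `S/J` of the ring of symmetric
polynomials, `S_j = S ∩ R_j`: the degree-`d` piece is the image of
`S ∩ (homogeneous polynomials of degree d)`. -/
noncomputable def symQuotGrading (J : Ideal ↥(symS K n)) (d : ℕ) :
    Submodule K (↥(symS K n) ⧸ J) :=
  Submodule.map (Ideal.Quotient.mkₐ K J).toLinearMap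
    (Submodule.comap (symS K n).val.toLinearMap
      (MvPolynomial.homogeneousSubmodule (Fin n) K d))

end PolyPrelude

universe u

section LocalAlgebra

open IsLocalRing RingTheory.Sequence CategoryTheory Abelian Limits

variable {A : Type u} [CommRing A] [IsLocalRing A] [IsNoetherianRing A]

open scoped Pointwise in
/-- If `r` is regular on `M` and `P` is an associated prime of `M`, then some associated prime
of `M / rM` contains both `P` and `r`. -/
theorem exists_isAssociatedPrime_quotSMulTop {M : Type*} [AddCommGroup M] [Module A M]
    [Module.Finite A M] {r : A} (hr : r ∈ maximalIdeal A) (hreg : IsSMulRegular M r)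
    {P : Ideal A} (hP : IsAssociatedPrime P M) :
    ∃ Q : Ideal A, IsAssociatedPrime Q (QuotSMulTop r M) ∧ P ≤ Q ∧ r ∈ Q := by
  obtain ⟨hPp, x, hx⟩ := isAssociatedPrime_iff.mp hP
  let N : Submodule A M :=
    { carrier := {m | ∀ p ∈ P, p • m = 0}
      add_mem' := fun {a b} ha hb p hp => by rw [smul_add, ha p hp, hb p hp, add_zero]
      zero_mem' := fun p _ => smul_zero p
      smul_mem' := fun c m hm p hp => by rw [smul_comm, hm p hp, smul_zero] }
  have hxN : x ∈ N := fun p hp => by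
    rw [hx, Submodule.mem_colon_singleton] at hp
    simpa using hp
  have hx0 : x ≠ 0 := by
    rintro rfl
    exact hPp.ne_top (by rw [hx]; ext; simp [Submodule.mem_colon_singleton])
  have hN : ¬ N ≤ r • (⊤ : Submodule A M) := by
    intro hle
    have hbot : N = ⊥ := by
      refine Submodule.eq_bot_of_le_smul_of_le_jacobson_bot (Ideal.span {r}) N
        (IsNoetherian.noetherian N) ?_ ?_
      · intro m hm
        obtain ⟨m', -, rfl⟩ := hle hm
        rw [Submodule.ideal_span_singleton_smul]
        refine Submodule.smul_mem_pointwise_smul m' r N fun p hp => hreg ?_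
        have := hm p hp
        simpa [smul_comm p r] using this
      · rw [Ideal.span_singleton_le_iff_mem]
        exact maximalIdeal_le_jacobson _ hr
    exact hx0 ((Submodule.mem_bot A).mp (hbot ▸ hxN))
  obtain ⟨m, hmN, hm⟩ := SetLike.not_le_iff_exists.mp hN
  obtain ⟨Q, hQ, hle⟩ := exists_le_isAssociatedPrime_of_isNoetherianRing A
    (Submodule.Quotient.mk (p := r • (⊤ : Submodule A M)) m)
    (by rwa [Ne, Submodule.Quotient.mk_eq_zero])
  refine ⟨Q, hQ, fun p hp => hle ?_, hle ?_⟩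
  · rw [Submodule.mem_colon_singleton, ← Submodule.Quotient.mk_smul, hmN p hp]
    simp
  · rw [Submodule.mem_colon_singleton, ← Submodule.Quotient.mk_smul, Submodule.mem_bot,
      Submodule.Quotient.mk_eq_zero]
    exact Submodule.smul_mem_pointwise_smul m r ⊤ trivial

/-- The length of a regular sequence on `M` is at most `dim A/P` for every associated prime `P`
of `M`. -/
theorem length_le_ringKrullDim_quotient_of_isAssociatedPrime {M : Type*} [AddCommGroup M]
    [Module A M] [Module.Finite A M] {rs : List A} (hmem : ∀ r ∈ rs, r ∈ maximalIdeal A)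
    (hreg : IsWeaklyRegular M rs) {P : Ideal A} (hP : IsAssociatedPrime P M) :
    (rs.length : WithBot ℕ∞) ≤ ringKrullDim (A ⧸ P) := by
  induction rs generalizing M P with
  | nil =>
    have := hP.isPrime
    simpa using ringKrullDim_nonneg_of_nontrivial
  | cons r rs ih =>
    rw [isWeaklyRegular_cons_iff] at hreg
    obtain ⟨Q, hQ, hPQ, hrQ⟩ :=
      exists_isAssociatedPrime_quotSMulTop (hmem r (by simp)) hreg.1 hP
    have hdim := ih (fun s hs => hmem s (by simp [hs])) hreg.2 hQ
    have := hP.isPrime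
    have hrP : r ∉ P := fun hrP => by
      have : r ∈ ⋃ p ∈ associatedPrimes A M, (p : Set A) := Set.mem_biUnion hP hrP
      rw [biUnion_associatedPrimes_eq_compl_regular] at this
      exact this hreg.1
    have hstep : ringKrullDim (A ⧸ Q) + 1 ≤ ringKrullDim (A ⧸ P) := by
      refine ringKrullDim_succ_le_of_surjective (Ideal.Quotient.factor hPQ)
        (Ideal.Quotient.factor_surjective hPQ) (r := Ideal.Quotient.mk P r) ?_ ?_
      · exact mem_nonZeroDivisors_of_ne_zero (by rwa [Ne, Ideal.Quotient.eq_zero_iff_mem])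
      · rw [Ideal.Quotient.factor_mk, Ideal.Quotient.eq_zero_iff_mem]
        exact hrQ
    refine le_trans ?_ hstep
    rw [List.length_cons]
    push_cast
    gcongr

/-- If `M` has depth at least `fs.length` and the maximal ideal is the only prime of the support
of `M` containing `fs`, then `fs` is regular on `M`. -/
theorem isWeaklyRegular_of_subsingleton_ext {M : Type u} [AddCommGroup M] [Module A M]
    [Module.Finite A M] [Nontrivial M] {fs : List A} (hmem : ∀ f ∈ fs, f ∈ maximalIdeal A)
    (hext : ∀ i < fs.length, Subsingleton
      (Ext (ModuleCat.of A (A ⧸ maximalIdeal A)) (ModuleCat.of A M) i))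
    (hprime : ∀ P : Ideal A, P.IsPrime → Module.annihilator A M ≤ P → (∀ f ∈ fs, f ∈ P) →
      P = maximalIdeal A) :
    IsWeaklyRegular M fs := by
  classical
  induction fs generalizing M with
  | nil => exact .nil A M
  | cons f fs ih =>
    have hfm : f ∈ maximalIdeal A := hmem f (by simp)
    have hsmul : maximalIdeal A • (⊤ : Submodule A M) < ⊤ := Ne.lt_top
      (Submodule.top_ne_ideal_smul_of_le_jacobson_annihilator (maximalIdeal_le_jacobson _)).symm
    have hf : IsSMulRegular M f := by
      by_contra hf
      have hf' : f ∈ ⋃ p ∈ associatedPrimes A M, (p : Set A) := by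
        rw [biUnion_associatedPrimes_eq_compl_regular]
        exact hf
      obtain ⟨P, hP, hfP⟩ := Set.mem_iUnion₂.mp hf'
      have hPp : P.IsPrime := hP.isPrime
      obtain ⟨rs, hlen, hrs, hreg⟩ := ModuleCat.exists_isRegular_of_exists_subsingleton_ext
        (maximalIdeal A) (f :: fs).length (ModuleCat.of A M) hsmul
        (ModuleCat.of A (A ⧸ maximalIdeal A)) (by
          change Module.support A (A ⧸ maximalIdeal A) = _
          rw [Module.support_eq_zeroLocus, Ideal.annihilator_quotient]) hext
      have hlower := length_le_ringKrullDim_quotient_of_isAssociatedPrime hrs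
        hreg.toIsWeaklyRegular hP
      let s : Finset (A ⧸ P) := (fs.map (Ideal.Quotient.mk P)).toFinset
      have hloc : IsLocalRing (A ⧸ P) :=
        .of_surjective' (Ideal.Quotient.mk P) Ideal.Quotient.mk_surjective
      have hs : (s : Set (A ⧸ P)) ⊆ maximalIdeal (A ⧸ P) := by
        intro y hy
        obtain ⟨g, hg, rfl⟩ : ∃ g ∈ fs, Ideal.Quotient.mk P g = y := by simpa [s] using hy
        have : IsLocalHom (Ideal.Quotient.mk P) := .of_surjective _ Ideal.Quotient.mk_surjective
        exact map_mem_nonunits_iff _ _ |>.mpr (hmem g (by simp [hg]))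
      have hupper := ringKrullDim_le_ringKrullDim_quotient_add_card s
        (by rwa [IsLocalRing.ringJacobson_eq_maximalIdeal])
      have hzero : Ring.KrullDimLE 0 ((A ⧸ P) ⧸ Ideal.span (s : Set (A ⧸ P))) := by
        rw [Ring.krullDimLE_zero_iff]
        intro J hJ
        let φ := (Ideal.Quotient.mk (Ideal.span (s : Set (A ⧸ P)))).comp (Ideal.Quotient.mk P)
        have hφ : Function.Surjective φ :=
          Ideal.Quotient.mk_surjective.comp Ideal.Quotient.mk_surjective
        have hPJ : P ≤ J.comap φ := fun p hp => by
          have : φ p = 0 := by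
            simp [φ, Ideal.Quotient.eq_zero_iff_mem.mpr hp]
          simp [Ideal.mem_comap, this]
        have hcomap : J.comap φ = maximalIdeal A := by
          refine hprime _ (Ideal.comap_isPrime φ J)
            (Submodule.annihilator_top.ge.trans (hP.annihilator_le.trans hPJ)) ?_
          intro g hg
          rcases List.mem_cons.mp hg with rfl | hg
          · exact hPJ hfP
          · have : φ g = 0 := Ideal.Quotient.eq_zero_iff_mem.mpr
              (Ideal.subset_span (by simpa [s] using ⟨g, hg, rfl⟩))
            simp [Ideal.mem_comap, this]
        have := Ideal.map_comap_of_surjective φ hφ J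
        rw [← this, hcomap]
        refine (Ideal.map_eq_top_or_isMaximal_of_surjective φ hφ
          (maximalIdeal.isMaximal A)).resolve_left ?_
        rw [← hcomap, this]
        exact hJ.ne_top
      have h0 : ringKrullDim ((A ⧸ P) ⧸ Ideal.span (s : Set (A ⧸ P))) ≤ 0 :=
        Order.KrullDimLE.krullDim_le
      have hcard : s.card ≤ fs.length := by
        simpa using (fs.map (Ideal.Quotient.mk P)).toFinset_card_le
      have hfinal : ((fs.length + 1 : ℕ) : WithBot ℕ∞) ≤ (fs.length : ℕ) :=
        calc ((fs.length + 1 : ℕ) : WithBot ℕ∞) = rs.length := by rw [hlen, List.length_cons]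
          _ ≤ _ := hlower
          _ ≤ _ := hupper
          _ ≤ 0 + (s.card : WithBot ℕ∞) := by gcongr
          _ = (s.card : WithBot ℕ∞) := zero_add _
          _ ≤ _ := by exact_mod_cast hcard
      have : fs.length + 1 ≤ fs.length := by exact_mod_cast hfinal
      omega
    refine .cons hf ?_
    have := nontrivial_quotSMulTop_of_mem_maximalIdeal M hfm
    refine ih (fun g hg => hmem g (by simp [hg])) ?_ ?_
    · intro i hi
      have zero₁ := AddCommGrpCat.isZero_of_iff_subsingleton.mpr
        (hext i (by simp only [List.length_cons]; omega))
      have zero₂ := AddCommGrpCat.isZero_of_iff_subsingleton.mpr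
        (hext (i + 1) (by simp only [List.length_cons]; omega))
      exact AddCommGrpCat.subsingleton_of_isZero <| ShortComplex.Exact.isZero_of_both_zeros
        (Ext.covariant_sequence_exact₃' _
          (IsSMulRegular.smulShortComplex_shortExact (M := ModuleCat.of A M) hf) i (i + 1) rfl)
        (zero₁.eq_zero_of_src _) (zero₂.eq_zero_of_tgt _)
    · intro P hP hann hfs
      have hann' : Module.annihilator A M ≤ P :=
        (LinearMap.annihilator_le_of_surjective (Submodule.mkQ _)
          (Submodule.mkQ_surjective _)).trans hann
      refine hprime P hP hann' fun g hg => ?_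
      rcases List.mem_cons.mp hg with rfl | hg
      · refine hann (Module.mem_annihilator.mpr fun m => ?_)
        obtain ⟨m, rfl⟩ := Submodule.Quotient.mk_surjective _ m
        rw [← Submodule.Quotient.mk_smul, Submodule.Quotient.mk_eq_zero]
        exact Submodule.smul_mem_pointwise_smul m g ⊤ trivial
      · exact hfs g hg

/-- In a Noetherian local ring with a regular sequence of length `fs.length`, the sequence `fs`
is regular as soon as the maximal ideal is the only prime containing it. -/
theorem isWeaklyRegular_of_isRegular_of_forall_isPrime {rs fs : List A}
    (hrs : IsRegular A rs) (hrsmem : ∀ r ∈ rs, r ∈ maximalIdeal A)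
    (hlen : fs.length = rs.length) (hmem : ∀ f ∈ fs, f ∈ maximalIdeal A)
    (hprime : ∀ P : Ideal A, P.IsPrime → (∀ f ∈ fs, f ∈ P) → P = maximalIdeal A) :
    IsWeaklyRegular A fs := by
  have hsmul : maximalIdeal A • (⊤ : Submodule A A) < ⊤ := Ne.lt_top
    (Submodule.top_ne_ideal_smul_of_le_jacobson_annihilator (maximalIdeal_le_jacobson _)).symm
  refine isWeaklyRegular_of_subsingleton_ext hmem ?_ fun P hP _ => hprime P hP
  intro i hi
  refine ModuleCat.subsingleton_ext_of_exists_isRegular (maximalIdeal A)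
    (ModuleCat.of A (A ⧸ maximalIdeal A)) ?_ (ModuleCat.of A A) hsmul rs hrsmem hrs i
    (hlen ▸ hi)
  change Module.support A (A ⧸ maximalIdeal A) ⊆ _
  rw [Module.support_eq_zeroLocus, Ideal.annihilator_quotient]

end LocalAlgebra

section PolynomialRing

open MvPolynomial RingTheory.Sequence

attribute [local instance] MvPolynomial.gradedAlgebra

variable {σ K : Type*} [Field K]

theorem mem_idealOfVars_iff_constantCoeff_eq_zero {p : MvPolynomial σ K} :
    p ∈ idealOfVars σ K ↔ constantCoeff p = 0 := by
  have := mem_pow_idealOfVars_iff' (σ := σ) (R := K) 1 p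
  rw [pow_one] at this
  simp only [this, Nat.lt_one_iff, Finsupp.degree_eq_zero_iff, forall_eq, constantCoeff_eq]

theorem idealOfVars_eq_ker_constantCoeff :
    idealOfVars σ K = RingHom.ker (constantCoeff (R := K) (σ := σ)) :=
  Ideal.ext fun _ => mem_idealOfVars_iff_constantCoeff_eq_zero

theorem idealOfVars_isMaximal : (idealOfVars σ K).IsMaximal := by
  rw [idealOfVars_eq_ker_constantCoeff]
  exact RingHom.ker_isMaximal_of_surjective _ fun c => ⟨C c, constantCoeff_C σ c⟩

/-- Elements outside the irrelevant ideal are nonzerodivisors modulo every homogeneous ideal. -/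
theorem mem_of_mul_mem_of_notMem_idealOfVars {J : Ideal (MvPolynomial σ K)}
    (hJ : J.IsHomogeneous (homogeneousSubmodule σ K)) {s u : MvPolynomial σ K}
    (hs : s ∉ idealOfVars σ K) (hsu : s * u ∈ J) : u ∈ J := by
  rw [mem_idealOfVars_iff_constantCoeff_eq_zero] at hs
  let w : MvPolynomial σ K := 1 - C (constantCoeff s)⁻¹ * s
  have hw : w ∈ idealOfVars σ K := by
    simp [mem_idealOfVars_iff_constantCoeff_eq_zero, w, hs]
  have hwu : (1 - w) * u ∈ J := by
    rw [show (1 - w) * u = C (constantCoeff s)⁻¹ * (s * u) by simp only [w]; ring]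
    exact J.mul_mem_left _ hsu
  rw [mem_iff_homogeneousComponent_mem hJ]
  intro d
  have hpow : (1 - w ^ (d + 1)) * u ∈ J := by
    obtain ⟨v, hv⟩ := sub_dvd_pow_sub_pow 1 w (d + 1)
    rw [one_pow] at hv
    rw [hv, mul_right_comm]
    exact J.mul_mem_right _ hwu
  have hzero : homogeneousComponent d (w ^ (d + 1) * u) = 0 := by
    ext m
    have := (mem_pow_idealOfVars_iff' (d + 1) _).mp
      (Ideal.mul_mem_right u _ (Ideal.pow_mem_pow hw (d + 1))) m
    rw [coeff_homogeneousComponent, coeff_zero]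
    split_ifs with hm
    · exact this (by omega)
    · rfl
  have hcomp := homogeneousComponent_mem_of_mem hJ hpow d
  rwa [sub_mul, one_mul, map_sub, hzero, sub_zero] at hcomp

theorem isWeaklyRegular_map_X {l : List σ} (hl : l.Nodup) :
    IsWeaklyRegular (MvPolynomial σ K) (l.map (X (R := K))) := by
  rw [isWeaklyRegular_iff]
  intro i hi
  have hspan : Ideal.ofList ((l.map (X (R := K))).take i) =
      Ideal.span (X '' {j | j ∈ l.take i} : Set (MvPolynomial σ K)) := by
    rw [← List.map_take, Ideal.ofList]
    congr 1
    ext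
    exact List.mem_map
  rw [smul_eq_mul, Ideal.mul_top, isSMulRegular_quotient_iff_mem_of_smul_mem, hspan]
  intro p hp
  rw [List.length_map] at hi
  rw [List.getElem_map, smul_eq_mul] at hp
  rw [mem_ideal_span_X_image] at hp ⊢
  intro m hm
  obtain ⟨j, hj, hmj⟩ := hp (Finsupp.single l[i] 1 + m) (by
    rw [mem_support_iff, coeff_X_mul]
    exact mem_support_iff.mp hm)
  refine ⟨j, hj, ?_⟩
  have hne : l[i] ≠ j := by
    rintro rfl
    obtain ⟨k, hk, hkeq⟩ := List.mem_iff_getElem.mp hj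
    rw [List.getElem_take, hl.getElem_inj_iff] at hkeq
    rw [List.length_take] at hk
    omega
  simpa [Finsupp.single_eq_of_ne' hne] using hmj

/-- A sequence of `n` homogeneous polynomials in `n` variables without constant terms, whose only
common prime is the irrelevant ideal, is weakly regular. -/
theorem isWeaklyRegular_of_forall_idealOfVars_le {n : ℕ} {K : Type} [Field K]
    {fs : List (MvPolynomial (Fin n) K)} (hlen : fs.length = n)
    (hhom : ∀ f ∈ fs, SetLike.IsHomogeneousElem (homogeneousSubmodule (Fin n) K) f)
    (hmem : ∀ f ∈ fs, f ∈ idealOfVars (Fin n) K)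
    (hprime : ∀ P : Ideal (MvPolynomial (Fin n) K), P.IsPrime → (∀ f ∈ fs, f ∈ P) →
      idealOfVars (Fin n) K ≤ P) :
    IsWeaklyRegular (MvPolynomial (Fin n) K) fs := by
  have hmax : (idealOfVars (Fin n) K).IsMaximal := idealOfVars_isMaximal
  let m := idealOfVars (Fin n) K
  let A := Localization.AtPrime m
  let φ : MvPolynomial (Fin n) K →+* A := algebraMap _ A
  have hmemφ : ∀ p ∈ m, φ p ∈ IsLocalRing.maximalIdeal A := fun p hp =>
    (IsLocalization.AtPrime.to_map_mem_maximal_iff A m p).mpr hp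
  have hXmem : ∀ r ∈ (List.finRange n).map (X : Fin n → MvPolynomial (Fin n) K), r ∈ m := by
    intro r hr
    obtain ⟨i, -, rfl⟩ := List.mem_map.mp hr
    exact Ideal.subset_span ⟨i, rfl⟩
  have hX : IsRegular A (((List.finRange n).map X).map φ) :=
    (isWeaklyRegular_map_X (List.nodup_finRange n)).isRegular_of_isLocalization_of_mem A m hXmem
  have hlocal : IsWeaklyRegular A (fs.map φ) := by
    refine isWeaklyRegular_of_isRegular_of_forall_isPrime hX ?_ (by simp [hlen]) ?_ ?_
    · simpa only [List.forall_mem_map] using fun r hr => hmemφ _ (hXmem _ (List.mem_map_of_mem hr))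
    · simpa only [List.forall_mem_map] using fun f hf => hmemφ f (hmem f hf)
    · intro P hP hfs
      refine le_antisymm (IsLocalRing.le_maximalIdeal hP.ne_top) ?_
      have hle : m ≤ P.comap φ := hprime _ (Ideal.comap_isPrime φ P) fun f hf =>
        hfs _ (List.mem_map_of_mem hf)
      rw [← Localization.AtPrime.map_eq_maximalIdeal]
      exact Ideal.map_le_iff_le_comap.mpr hle
  rw [isWeaklyRegular_iff]
  intro i hi
  rw [smul_eq_mul, Ideal.mul_top, isSMulRegular_quotient_iff_mem_of_smul_mem]
  intro u hu
  have hreg := hlocal.regular_mod_prev i (by simpa using hi)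
  rw [smul_eq_mul, Ideal.mul_top, isSMulRegular_quotient_iff_mem_of_smul_mem, ← List.map_take,
    ← Ideal.map_ofList, List.getElem_map] at hreg
  obtain ⟨s, hs, hsu⟩ := (IsLocalization.algebraMap_mem_map_algebraMap_iff m.primeCompl A _ u).mp
    (hreg (φ u) (by
      rw [smul_eq_mul, ← map_mul]
      exact Ideal.mem_map_of_mem φ hu))
  exact mem_of_mul_mem_of_notMem_idealOfVars
    (Ideal.homogeneous_span _ _ fun f hf => hhom f (List.mem_of_mem_take hf)) hs hsu

end PolynomialRing

section PowerSums

open MvPolynomial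

/-- Over a domain of characteristic zero, a tuple of `n` elements all of whose power sums of
degrees `a, …, a + n - 1` vanish is zero. -/
theorem eq_zero_of_forall_sum_pow_eq_zero {D : Type*} [CommRing D] [IsDomain D] [CharZero D]
    {n a : ℕ} {y : Fin n → D} (h : ∀ j < n, ∑ i, y i ^ (a + j) = 0) (i : Fin n) : y i = 0 := by
  classical
  have hpoly : ∀ q : Polynomial D, q.natDegree < n → ∑ k, y k ^ a * q.eval (y k) = 0 := by
    intro q hq
    simp_rw [Polynomial.eval_eq_sum_range' hq, Finset.mul_sum]
    rw [Finset.sum_comm]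
    refine Finset.sum_eq_zero fun j hj => ?_
    rw [← mul_zero (q.coeff j), ← h j (Finset.mem_range.mp hj), Finset.mul_sum]
    exact Finset.sum_congr rfl fun k _ => by ring
  let s := (Finset.univ.image y).erase (y i)
  let q : Polynomial D := ∏ z ∈ s, (Polynomial.X - Polynomial.C z)
  have hdeg : q.natDegree < n := by
    rw [Polynomial.natDegree_prod_of_monic _ _ fun z _ => Polynomial.monic_X_sub_C z]
    simp only [Polynomial.natDegree_X_sub_C, Finset.sum_const, smul_eq_mul, mul_one]
    have hi : y i ∈ Finset.univ.image y := Finset.mem_image_of_mem y (Finset.mem_univ i)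
    have hcard : (Finset.univ.image y).card ≤ n := by
      simpa using Finset.card_image_le (s := Finset.univ) (f := y)
    exact (Finset.card_erase_lt_of_mem hi).trans_le hcard
  have hval : ∀ k, y k ^ a * q.eval (y k) = if y k = y i then y i ^ a * q.eval (y i) else 0 := by
    intro k
    split_ifs with hk
    · rw [hk]
    · rw [Polynomial.eval_prod, Finset.prod_eq_zero (i := y k) (by simp [s, hk]) (by simp),
        mul_zero]
  have hsum := hpoly q hdeg
  rw [Finset.sum_congr rfl fun k _ => hval k, ← Finset.sum_filter, Finset.sum_const,
    nsmul_eq_mul, mul_eq_zero, Nat.cast_eq_zero, Finset.card_eq_zero] at hsum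
  have hcard : Finset.univ.filter (fun k => y k = y i) ≠ ∅ :=
    Finset.ne_empty_of_mem (a := i) (by simp)
  have hq : q.eval (y i) ≠ 0 := by
    rw [Polynomial.eval_prod, Finset.prod_ne_zero_iff]
    intro z hz
    simpa [sub_eq_zero] using (Finset.ne_of_mem_erase hz).symm
  exact eq_zero_of_pow_eq_zero <| (mul_eq_zero.mp (hsum.resolve_left hcard)).resolve_right hq

theorem idealOfVars_le_of_forall_psum_mem {K : Type*} [Field K] [CharZero K] {n a : ℕ}
    {P : Ideal (MvPolynomial (Fin n) K)} (hP : P.IsPrime)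
    (h : ∀ j < n, psum (Fin n) K (a + j) ∈ P) : idealOfVars (Fin n) K ≤ P := by
  have hchar : CharZero (MvPolynomial (Fin n) K ⧸ P) :=
    charZero_of_injective_algebraMap (algebraMap K (MvPolynomial (Fin n) K ⧸ P)).injective
  rw [Ideal.span_le]
  rintro _ ⟨i, rfl⟩
  refine Ideal.Quotient.eq_zero_iff_mem.mp
    (eq_zero_of_forall_sum_pow_eq_zero (a := a) (y := fun i => Ideal.Quotient.mk P (X i)) ?_ i)
  intro j hj
  simpa [psum] using Ideal.Quotient.eq_zero_iff_mem.mpr (h j hj)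

theorem psum_isHomogeneous (σ R : Type*) [Fintype σ] [CommSemiring R] (d : ℕ) :
    (psum σ R d).IsHomogeneous d :=
  IsHomogeneous.sum _ _ _ fun i _ => isHomogeneous_X_pow i d

theorem psum_mem_idealOfVars (σ R : Type*) [Fintype σ] [CommSemiring R] {d : ℕ} (hd : d ≠ 0) :
    psum σ R d ∈ idealOfVars σ R :=
  Ideal.sum_mem _ fun i _ => Ideal.pow_mem_of_mem _ (Ideal.subset_span (Set.mem_range_self i)) d
    (Nat.pos_of_ne_zero hd)

end PowerSums

/-- Lemma 7.2. Let `K` be a field of characteristic zero.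
For every positive integer `a`, the power sums `p_a, p_{a+1}, …, p_{a+n-1}` form
a regular sequence in `R = K[x₁, …, x_n]`; equivalently the ideal
`I = (p_a, …, p_{a+n-1})` is a complete intersection and `R/I` is Artinian. -/
theorem statement_13 (K : Type) [Field K] [CharZero K] (n : ℕ) (hn : 0 < n)
    (a : ℕ) (ha : 0 < a) :
    RingTheory.Sequence.IsRegular (MvPolynomial (Fin n) K)
      ((List.range n).map fun j => MvPolynomial.psum (Fin n) K (a + j)) ∧
    IsArtinianRing (MvPolynomial (Fin n) K ⧸
      Ideal.span (Set.range fun j : Fin n => MvPolynomial.psum (Fin n) K (a + j))) := by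
  have hmem : ∀ f ∈ (List.range n).map fun j => MvPolynomial.psum (Fin n) K (a + j),
      f ∈ MvPolynomial.idealOfVars (Fin n) K := by
    simpa only [List.forall_mem_map] using fun j _ => psum_mem_idealOfVars (Fin n) K (by omega)
  constructor
  · refine ⟨isWeaklyRegular_of_forall_idealOfVars_le (by simp) ?_ hmem ?_, ?_⟩
    · simpa only [List.forall_mem_map] using fun j _ => ⟨a + j, psum_isHomogeneous (Fin n) K _⟩
    · intro P hP hfs
      exact idealOfVars_le_of_forall_psum_mem hP fun j hj =>
        hfs _ (List.mem_map_of_mem (List.mem_range.mpr hj))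
    · rw [smul_eq_mul, Ideal.mul_top]
      exact (ne_top_of_le_ne_top idealOfVars_isMaximal.ne_top (Ideal.span_le.mpr hmem)).symm
  · rw [isArtinianRing_iff_isNoetherianRing_krullDimLE_zero, Ring.krullDimLE_zero_iff]
    refine ⟨inferInstance, fun P hP => ?_⟩
    let I := Ideal.span (Set.range fun j : Fin n => MvPolynomial.psum (Fin n) K (a + j))
    let Q := P.comap (Ideal.Quotient.mk I)
    have hIQ : I ≤ Q := fun p hp => by
      rw [Ideal.mem_comap, Ideal.Quotient.eq_zero_iff_mem.mpr hp]
      exact P.zero_mem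
    have hQ : Q.IsPrime := Ideal.comap_isPrime (Ideal.Quotient.mk I) P
    have hle : MvPolynomial.idealOfVars (Fin n) K ≤ Q :=
      idealOfVars_le_of_forall_psum_mem hQ fun j hj => hIQ (Ideal.subset_span ⟨⟨j, hj⟩, rfl⟩)
    have hQmax : Q.IsMaximal := idealOfVars_isMaximal.eq_of_le hQ.ne_top hle ▸ idealOfVars_isMaximal
    rw [← Ideal.map_comap_of_surjective _ Ideal.Quotient.mk_surjective P]
    refine (Ideal.map_eq_top_or_isMaximal_of_surjective _ Ideal.Quotient.mk_surjective
      hQmax).resolve_left ?_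
    rw [Ideal.map_comap_of_surjective _ Ideal.Quotient.mk_surjective P]
    exact hP.ne_top
end

section
/- Let K be a field, C = ⊕_{i=0}^{c} C_i a graded Artinian K-algebra with the SLP and C_c ≠ 0, and B = ⊕_{i=0}^{c} B_i a graded K-subalgebra of C (with B_i = B ∩ C_i) such that B_c ≠ 0. If B contains a strong Lefschetz element z ∈ C_1 of C and the Hilbert function of B is symmetric, then B has the SLP (indeed z is a strong Lefschetz element of B). -/
set_option maxHeartbeats 1000000
set_option synthInstance.maxHeartbeats 400000

open TensorProduct

/-- Lemma 7.3. Let `C = ⊕_{i=0}^{c} C_i` be a graded Artinian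
`K`-algebra with the SLP and let `B` be a graded `K`-subalgebra of `C` (graded
by `B_i = B ∩ C_i`) with `B_c ≠ 0`.  If `B` contains a strong Lefschetz element
`z ∈ C₁` of `C` and the Hilbert function of `B` is symmetric, then `B` has the
SLP; indeed `z` is a strong Lefschetz element of `B`. -/
theorem statement_14 {K C : Type} [Field K] [CommRing C] [Algebra K C]
    (𝒞 : ℕ → Submodule K C) (c : ℕ)
    (hC : IsGradedArtinAlg K 𝒞) (htop : GradedTop K 𝒞 c)
    (B : Subalgebra K C)
    (hBgraded : B.toSubmodule = ⨆ i : ℕ, B.toSubmodule ⊓ 𝒞 i)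
    (hBc : B.toSubmodule ⊓ 𝒞 c ≠ ⊥)
    (hsym : ∀ i : ℕ, i ≤ c →
      Module.finrank K ↥(B.toSubmodule ⊓ 𝒞 i) =
        Module.finrank K ↥(B.toSubmodule ⊓ 𝒞 (c - i)))
    (z : C) (hzB : z ∈ B) (hz : IsAlgSLElem K 𝒞 c z) :
    IsAlgSLElem K (fun i => B.toSubmodule ⊓ 𝒞 i) c z := by
  obtain ⟨-, hone, hmul, -, hfin⟩ := hC
  refine ⟨⟨hzB, hz.1⟩, fun i hi => ?_⟩
  have hinj : ∀ v ∈ B.toSubmodule ⊓ 𝒞 i, z ^ (c - 2 * i) * v = 0 → v = 0 :=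
    fun v hv => (hz.2 i hi).1 v hv.2
  refine ⟨hinj, fun w hw => ?_⟩
  have hpow : ∀ n : ℕ, z ^ n ∈ 𝒞 n := by
    intro n
    induction n with
    | zero => simpa using hone
    | succ n ih => simpa only [pow_succ] using hmul n 1 _ ih z hz.1
  have hmaps : ∀ v ∈ B.toSubmodule ⊓ 𝒞 i,
      LinearMap.mulLeft K (z ^ (c - 2 * i)) v ∈ B.toSubmodule ⊓ 𝒞 (c - i) := by
    rintro v ⟨hvB, hvC⟩
    refine ⟨B.mul_mem (B.pow_mem hzB _) hvB, ?_⟩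
    have hdeg : c - 2 * i + i = c - i := by omega
    simpa only [hdeg, LinearMap.mulLeft_apply, SetLike.mem_coe] using hmul _ _ _ (hpow (c - 2 * i)) v hvC
  let f := (LinearMap.mulLeft K (z ^ (c - 2 * i))).restrict hmaps
  have hf : Function.Injective f := by
    refine (injective_iff_map_eq_zero f).2 fun v hv => Subtype.ext ?_
    exact hinj v v.2 (congrArg Subtype.val hv)
  obtain ⟨v, hv⟩ :=
    (LinearMap.injective_iff_surjective_of_finrank_eq_finrank (hsym i (by omega))).1 hf ⟨w, hw⟩
  exact ⟨v, v.2, congrArg Subtype.val hv⟩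
end

section
/- Let K be a field of characteristic zero and a a positive integer. Then the Artinian complete intersection B = K[e_1, e_2, ..., e_n]/(p_a, p_{a+1}, ..., p_{a+n−1}) has the SLP; indeed the image of e_1 is a strong Lefschetz element of B. Here K[e_1, ..., e_n] = S is the subring of symmetric polynomials of R = K[x_1, ..., x_n] with its induced (non-standard) grading. -/
set_option maxHeartbeats 1000000
set_option synthInstance.maxHeartbeats 400000

open TensorProduct

section SlTwo

open Polynomial Module

variable {K V : Type*} [Field K] [AddCommGroup V] [Module K V]

theorem aeval_apply_mem {T : End K V} {M : Submodule K V} (hT : ∀ f ∈ M, T f ∈ M)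
    (p : K[X]) {f : V} (hf : f ∈ M) : aeval T p f ∈ M := by
  have hpow : ∀ k : ℕ, (T ^ k) f ∈ M := fun k => by
    induction k with
    | zero => simpa using hf
    | succ k ih => rw [pow_succ', End.mul_apply]; exact hT _ ih
  rw [aeval_eq_sum_range, LinearMap.sum_apply]
  exact M.sum_mem fun k _ => M.smul_mem _ (hpow k)

theorem aeval_X_sub_C_apply (T : End K V) (r : K) (f : V) :
    aeval T (X - C r) f = T f - r • f := by
  rw [map_sub, aeval_X, aeval_C, LinearMap.sub_apply, algebraMap_end_apply]

/-- A graded space `M` with operators `E` and `F` of degrees `1` and `-1` satisfying the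
commutation relation of an `𝔰𝔩₂`-representation in which `M d` has weight `2 * d - c`. -/
structure IsLefschetzPair (M : ℕ → Submodule K V) (E F : End K V) (c : K) : Prop where
  raise_mem : ∀ d, ∀ f ∈ M d, E f ∈ M (d + 1)
  lower_mem : ∀ d, ∀ f ∈ M (d + 1), F f ∈ M d
  lower_zero : ∀ f ∈ M 0, F f = 0
  comm : ∀ d, ∀ f ∈ M d, F (E f) = E (F f) + (c - 2 * d) • f

namespace IsLefschetzPair

variable {M : ℕ → Submodule K V} {E F : End K V} {c : K} (h : IsLefschetzPair M E F c)
include h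

theorem raise_lower_mem {d : ℕ} {f : V} (hf : f ∈ M d) : (E * F) f ∈ M d := by
  cases d with
  | zero => simp [h.lower_zero f hf]
  | succ d => exact h.raise_mem _ _ (h.lower_mem _ _ hf)

theorem raise_pow_mem {d : ℕ} {f : V} (hf : f ∈ M d) (j : ℕ) : (E ^ j) f ∈ M (d + j) := by
  induction j with
  | zero => simpa using hf
  | succ j ih => rw [pow_succ', End.mul_apply]; exact h.raise_mem _ _ ih

theorem lower_pow_mem {d j : ℕ} {f : V} (hf : f ∈ M (d + j)) : (F ^ j) f ∈ M d := by
  induction j generalizing d with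
  | zero => simpa using hf
  | succ j ih =>
    rw [pow_succ', End.mul_apply]
    exact h.lower_mem _ _ (ih (by rwa [add_right_comm, add_assoc]))

theorem lower_pow_eq_zero {d : ℕ} {f : V} (hf : f ∈ M d) : (F ^ (d + 1)) f = 0 := by
  rw [pow_succ', End.mul_apply]
  exact h.lower_zero _ (h.lower_pow_mem (by simpa using hf))

theorem raise_lower_raise_pow {d : ℕ} {f : V} (hf : f ∈ M d) (j : ℕ) :
    (F * E) ((E ^ j) f) =
      (E ^ j) ((E * F) f + (((j : K) + 1) * ((c - 2 * d) - j)) • f) := by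
  induction j with
  | zero => simp [h.comm d f hf]
  | succ j ih =>
    have key := h.comm _ _ (h.raise_pow_mem hf (j + 1))
    have hE : E (F ((E ^ (j + 1)) f)) = E ((F * E) ((E ^ j) f)) := by
      rw [pow_succ']; rfl
    rw [hE, ih, ← End.mul_apply F E, ← End.mul_apply E (E ^ j), ← pow_succ'] at key
    rw [key]
    simp only [map_add, map_smul]
    rw [add_assoc, ← add_smul]
    congr 2
    push_cast
    ring

theorem raise_lower_lower_pow {d : ℕ} {f : V} (hf : f ∈ M d) (j : ℕ) :
    (E * F) ((F ^ j) f) = (F ^ j) ((E * F) f - ((j : K) * (c - 2 * d + 1 + j)) • f) := by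
  induction j with
  | zero => simp
  | succ j ih =>
    by_cases hj : d < j + 1
    · have hz : ∀ g ∈ M d, (F ^ (j + 1)) g = 0 := fun g hg => by
        obtain ⟨r, hr⟩ := Nat.exists_eq_add_of_le (Nat.succ_le_of_lt hj)
        rw [hr, Nat.succ_eq_add_one, add_comm, pow_add, End.mul_apply, h.lower_pow_eq_zero hg,
          map_zero]
      rw [hz f hf, hz _ (sub_mem (h.raise_lower_mem hf) (Submodule.smul_mem _ _ hf)), map_zero]
    · obtain ⟨r, rfl⟩ := Nat.exists_eq_add_of_le' (not_lt.mp hj)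
      have key := h.comm _ _ (h.lower_pow_mem hf)
      have hF : F (E ((F ^ (j + 1)) f)) = F ((E * F) ((F ^ j) f)) := by
        rw [pow_succ']; rfl
      rw [hF, ih, ← End.mul_apply, ← pow_succ'] at key
      rw [End.mul_apply, ← sub_eq_iff_eq_add.mpr key]
      simp only [map_sub, map_smul]
      rw [sub_sub, ← add_smul]
      congr 2
      push_cast
      ring

theorem raise_pow_lower_pow {d : ℕ} {f : V} (hf : f ∈ M d) (j : ℕ) :
    (E ^ j) ((F ^ j) f) =
      aeval (E * F) (∏ t ∈ Finset.range j, (X - C ((t : K) * (c - 2 * d + 1 + t)))) f := by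
  induction j generalizing f with
  | zero => simp
  | succ j ih =>
    rw [pow_succ, pow_succ' F, End.mul_apply, End.mul_apply, ← End.mul_apply E F,
      h.raise_lower_lower_pow hf,
      ih (sub_mem (h.raise_lower_mem hf) (Submodule.smul_mem _ _ hf)), Finset.prod_range_succ,
      map_mul, End.mul_apply (aeval (E * F) _), aeval_X_sub_C_apply]

theorem lower_pow_raise_pow {d : ℕ} {f : V} (hf : f ∈ M d) (j : ℕ) :
    (F ^ j) ((E ^ j) f) =
      aeval (E * F) (∏ t ∈ Finset.range j, (X - C (-(((t : K) + 1) * (c - 2 * d - t))))) f := by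
  induction j generalizing f with
  | zero => simp
  | succ j ih =>
    rw [pow_succ, pow_succ' E, End.mul_apply, End.mul_apply, ← End.mul_apply F E,
      h.raise_lower_raise_pow hf,
      ih (add_mem (h.raise_lower_mem hf) (Submodule.smul_mem _ _ hf)), Finset.prod_range_succ,
      map_mul, End.mul_apply (aeval (E * F) _), aeval_X_sub_C_apply, neg_smul, sub_neg_eq_add]

end IsLefschetzPair

theorem isCoprime_prod_X_sub_C {r s : ℕ → K} {p q : ℕ}
    (hrs : ∀ t < p, ∀ u < q, r t ≠ s u) :
    IsCoprime (∏ t ∈ Finset.range p, (X - C (r t))) (∏ u ∈ Finset.range q, (X - C (s u))) :=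
  IsCoprime.prod_left fun t ht => IsCoprime.prod_right fun u hu =>
    isCoprime_X_sub_C_of_isUnit_sub
      (sub_ne_zero_of_ne (hrs t (Finset.mem_range.mp ht) u (Finset.mem_range.mp hu))).isUnit

namespace IsLefschetzPair

variable [CharZero K] {M : ℕ → Submodule K V} {E F : End K V} {c : ℕ}
  (h : IsLefschetzPair M E F (c : K)) {I : Submodule K V}
  (hE : ∀ f ∈ I, E f ∈ I) (hF : ∀ f ∈ I, F f ∈ I)
include h hE hF

theorem mem_of_raise_pow_mem {d : ℕ} (hd : 2 * d ≤ c) {f : V} (hf : f ∈ M d)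
    (hfI : (E ^ (c - 2 * d)) f ∈ I) : f ∈ I := by
  have hT : ∀ g ∈ I, (E * F) g ∈ I := fun g hg => hE _ (hF _ hg)
  have hFpow : ∀ (j : ℕ), ∀ g ∈ I, (F ^ j) g ∈ I := fun j g hg => by
    simpa using aeval_apply_mem hF (X ^ j) hg
  obtain ⟨k, rfl⟩ := Nat.exists_eq_add_of_le hd
  rw [Nat.add_sub_cancel_left] at hfI
  have h0 := h.raise_pow_lower_pow hf (d + 1)
  rw [h.lower_pow_eq_zero hf, map_zero] at h0
  have h1 := hFpow k _ hfI
  rw [h.lower_pow_raise_pow hf] at h1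
  obtain ⟨u, v, huv⟩ := isCoprime_prod_X_sub_C (K := K) (p := d + 1) (q := k)
    (r := fun t => (t : K) * (((2 * d + k : ℕ) : K) - 2 * d + 1 + t))
    (s := fun t => -(((t : K) + 1) * (((2 * d + k : ℕ) : K) - 2 * d - t))) (by
      intro t _ u hu heq
      obtain ⟨e, rfl⟩ := Nat.exists_eq_add_of_lt hu
      have : ((t * (u + e + 1 + 1 + t) + (u + 1) * (e + 1) : ℕ) : K) = 0 := by
        push_cast at heq ⊢
        linear_combination heq
      rw [Nat.cast_eq_zero] at this
      have : 0 < (u + 1) * (e + 1) := by positivity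
      omega)
  have hfe := LinearMap.congr_fun (congrArg (aeval (E * F)) huv) f
  rw [map_add, map_mul, map_mul, map_one, LinearMap.add_apply, End.mul_apply, End.mul_apply,
    End.one_apply] at hfe
  rw [← h0, map_zero, zero_add] at hfe
  rw [← hfe]
  exact aeval_apply_mem hT _ h1

theorem exists_raise_pow_sub_mem (hI : ∀ d, c < d → M d ≤ I) {d : ℕ} (hd : 2 * d ≤ c)
    {w : V} (hw : w ∈ M (c - d)) : ∃ f ∈ M d, (E ^ (c - 2 * d)) f - w ∈ I := by
  have hT : ∀ g ∈ I, (E * F) g ∈ I := fun g hg => hE _ (hF _ hg)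
  have hFpow : ∀ (j : ℕ), ∀ g ∈ I, (F ^ j) g ∈ I := fun j g hg => by
    simpa using aeval_apply_mem hF (X ^ j) hg
  obtain ⟨k, rfl⟩ := Nat.exists_eq_add_of_le hd
  rw [Nat.add_sub_cancel_left]
  have hdk : 2 * d + k - d = d + k := by omega
  rw [hdk] at hw
  have h1 := hFpow (d + 1) _ (hI _ (by omega) (h.raise_pow_mem hw (d + 1)))
  rw [h.lower_pow_raise_pow hw] at h1
  obtain ⟨u, v, huv⟩ := isCoprime_prod_X_sub_C (K := K) (p := k) (q := d + 1)
    (r := fun t => (t : K) * (((2 * d + k : ℕ) : K) - 2 * ((d + k : ℕ) : K) + 1 + t))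
    (s := fun t => -(((t : K) + 1) * (((2 * d + k : ℕ) : K) - 2 * ((d + k : ℕ) : K) - t))) (by
      intro t ht u _ heq
      obtain ⟨e, rfl⟩ := Nat.exists_eq_add_of_lt ht
      have : ((t * e + (u + 1) * (t + e + 1 + u) : ℕ) : K) = 0 := by
        push_cast at heq ⊢
        linear_combination -heq
      rw [Nat.cast_eq_zero] at this
      have : 0 < (u + 1) * (t + e + 1 + u) := by positivity
      omega)
  have hMT : ∀ g ∈ M (d + k), (E * F) g ∈ M (d + k) := fun g hg => h.raise_lower_mem hg
  refine ⟨(F ^ k) (aeval (E * F) u w), h.lower_pow_mem (aeval_apply_mem hMT u hw), ?_⟩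
  rw [h.raise_pow_lower_pow (aeval_apply_mem hMT u hw)]
  have hwe := LinearMap.congr_fun (congrArg (aeval (E * F)) huv) w
  rw [mul_comm u] at hwe
  rw [map_add, map_mul, map_mul, map_one, LinearMap.add_apply, End.mul_apply, End.mul_apply,
    End.one_apply] at hwe
  rw [← eq_sub_iff_add_eq] at hwe
  rw [hwe, sub_sub_cancel_left]
  exact neg_mem (aeval_apply_mem hT _ h1)

end IsLefschetzPair

end SlTwo

section SymmetricQuotient

open MvPolynomial Module

variable (K : Type) [Field K] (n : ℕ)

/-- The polynomials all of whose monomials are divisible by the `a`-th power of a variable. -/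
noncomputable def powerSpan (a : ℕ) : Submodule K (MvPolynomial (Fin n) K) :=
  restrictSupport K {m | ∃ i, a ≤ m i}

/-- The symmetric homogeneous polynomials of degree `d`. -/
noncomputable def symHomogeneous (d : ℕ) : Submodule K (MvPolynomial (Fin n) K) :=
  Subalgebra.toSubmodule (symS K n) ⊓ homogeneousSubmodule (Fin n) K d

/-- The operator `∑ i, ((a - 1) ∂ᵢ - xᵢ ∂ᵢ²)`, which forms an `𝔰𝔩₂`-triple with the
multiplication by `e₁`. -/
noncomputable def lowering (a : ℕ) : End K (MvPolynomial (Fin n) K) :=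
  ∑ i, (((a : K) - 1) • (pderiv i).toLinearMap -
    LinearMap.mulLeft K (X i) ∘ₗ (pderiv i).toLinearMap ∘ₗ (pderiv i).toLinearMap)

variable {K n}

theorem mem_powerSpan {a : ℕ} {f : MvPolynomial (Fin n) K} :
    f ∈ powerSpan K n a ↔ ∀ m ∈ f.support, ∃ i, a ≤ m i := by
  rw [powerSpan, mem_restrictSupport_iff]
  rfl

theorem monomial_mem_powerSpan {a : ℕ} {m : Fin n →₀ ℕ} {i : Fin n} (h : a ≤ m i) (r : K) :
    monomial m r ∈ powerSpan K n a := by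
  rw [powerSpan, monomial_mem_restrictSupport]
  exact Or.inl ⟨i, h⟩

theorem powerSpan_induction {a : ℕ} {N : Submodule K (MvPolynomial (Fin n) K)}
    (h : ∀ (m : Fin n →₀ ℕ) (i : Fin n), a ≤ m i → monomial m 1 ∈ N) :
    powerSpan K n a ≤ N := by
  rw [powerSpan, restrictSupport_eq_span, Submodule.span_le]
  rintro _ ⟨m, ⟨i, hi⟩, rfl⟩
  exact h m i hi

theorem mul_mem_powerSpan {a : ℕ} (g : MvPolynomial (Fin n) K) {f : MvPolynomial (Fin n) K}
    (hf : f ∈ powerSpan K n a) : g * f ∈ powerSpan K n a := by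
  have hs : IsUpperSet {m : Fin n →₀ ℕ | ∃ i, a ≤ m i} := fun m m' hm ⟨i, hi⟩ =>
    ⟨i, hi.trans (hm i)⟩
  exact (restrictSupportIdeal (R := K) _ hs).mul_mem_left g hf

theorem homogeneous_le_powerSpan {a d : ℕ} (ha : 0 < a) (hd : n * a - n < d) :
    homogeneousSubmodule (Fin n) K d ≤ powerSpan K n a := by
  intro f hf
  rw [mem_powerSpan]
  intro m hm
  by_contra! hlt
  have hdeg : m.degree = d := by
    rw [Finsupp.degree_eq_weight_one]
    exact (mem_homogeneousSubmodule d f).mp hf (mem_support_iff.mp hm)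
  have : m.degree ≤ n * (a - 1) := by
    rw [Finsupp.degree_eq_sum]
    refine (Finset.sum_le_card_nsmul _ _ (a - 1) fun i _ => ?_).trans (by simp)
    have := hlt i
    omega
  rw [Nat.mul_sub, mul_one] at this
  omega

theorem lowering_apply (a : ℕ) (f : MvPolynomial (Fin n) K) :
    lowering K n a f =
      ∑ i, (((a : K) - 1) • pderiv i f - X i * pderiv i (pderiv i f)) := by
  simp [lowering]

theorem X_mul_pderiv_pderiv_monomial (m : Fin n →₀ ℕ) (i : Fin n) (r : K) :
    X i * pderiv i (pderiv i (monomial m r)) =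
      monomial (m - Finsupp.single i 1) (r * m i * ((m i : K) - 1)) := by
  rw [pderiv_monomial, pderiv_monomial, X, monomial_mul]
  rcases Nat.lt_or_ge (m i) 2 with h | h
  · obtain h | h : m i = 0 ∨ m i = 1 := by omega
    all_goals simp [h]
  · have hexp : Finsupp.single i 1 + (m - Finsupp.single i 1 - Finsupp.single i 1) =
        m - Finsupp.single i 1 := by
      ext j
      by_cases hj : j = i
      · subst hj
        simp
        omega
      · simp [Finsupp.single_eq_of_ne hj]
    rw [hexp, one_mul]
    simp only [Finsupp.coe_tsub, Pi.sub_apply, Finsupp.single_eq_same]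
    rw [Nat.cast_sub (by omega), Nat.cast_one]

theorem lowering_mem_powerSpan {a : ℕ} {f : MvPolynomial (Fin n) K}
    (hf : f ∈ powerSpan K n a) : lowering K n a f ∈ powerSpan K n a := by
  refine powerSpan_induction (N := (powerSpan K n a).comap (lowering K n a)) (fun m i hi => ?_) hf
  rw [Submodule.mem_comap, lowering_apply]
  refine Submodule.sum_mem _ fun j _ => ?_
  rw [X_mul_pderiv_pderiv_monomial, pderiv_monomial, smul_monomial, ← map_sub]
  by_cases hj : j = i ∧ m i = a
  · obtain ⟨rfl, hm⟩ := hj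
    rw [hm, smul_eq_mul, one_mul, mul_comm, sub_self, map_zero]
    exact zero_mem _
  · refine monomial_mem_powerSpan (i := i) ?_ _
    by_cases hji : j = i
    · subst hji
      simp
      omega
    · simpa [Finsupp.single_eq_of_ne' hji] using hi

theorem rename_lowering (a : ℕ) (e : Equiv.Perm (Fin n)) (f : MvPolynomial (Fin n) K) :
    rename e (lowering K n a f) = lowering K n a (rename e f) := by
  rw [lowering_apply, lowering_apply, map_sum, ← Equiv.sum_comp e fun j => _ - _]
  refine Finset.sum_congr rfl fun i _ => ?_
  simp only [pderiv_rename e.injective, map_sub, map_smul, map_mul, rename_X]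

theorem lowering_esymm_one_mul {a d : ℕ} {f : MvPolynomial (Fin n) K} (hf : f.IsHomogeneous d) :
    lowering K n a (esymm (Fin n) K 1 * f) =
      esymm (Fin n) K 1 * lowering K n a f + ((n : K) * (a - 1) - 2 * d) • f := by
  have hpd : ∀ i, pderiv i (esymm (Fin n) K 1) = 1 := fun i => by
    simp [esymm_one, pderiv_X, Pi.single_apply]
  have heuler := hf.sum_X_mul_pderiv
  rw [lowering_apply, lowering_apply, Finset.mul_sum]
  have hterm : ∀ i, ((a : K) - 1) • pderiv i (esymm (Fin n) K 1 * f) -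
      X i * pderiv i (pderiv i (esymm (Fin n) K 1 * f)) =
      esymm (Fin n) K 1 * (((a : K) - 1) • pderiv i f - X i * pderiv i (pderiv i f)) +
        (((a : K) - 1) • f - (2 : K) • (X i * pderiv i f)) := fun i => by
    simp only [Derivation.leibniz, hpd, map_add, smul_eq_mul, smul_add, mul_one,
      smul_eq_C_mul, map_ofNat]
    ring
  rw [Finset.sum_congr rfl fun i _ => hterm i, Finset.sum_add_distrib, Finset.sum_sub_distrib,
    ← Finset.smul_sum, ← Finset.smul_sum, heuler]
  simp only [Finset.sum_const, Finset.card_univ, Fintype.card_fin, smul_eq_C_mul, nsmul_eq_mul,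
    map_sub, map_mul, map_natCast, map_ofNat, map_one]
  ring

theorem isLefschetzPair_symHomogeneous {a : ℕ} (ha : 0 < a) :
    IsLefschetzPair (symHomogeneous K n) (LinearMap.mulLeft K (esymm (Fin n) K 1))
      (lowering K n a) ((n * a - n : ℕ) : K) where
  raise_mem d f hf := by
    refine ⟨(symS K n).mul_mem (esymmS K n 1).2 hf.1, ?_⟩
    rw [add_comm]
    refine IsHomogeneous.mul ?_ hf.2
    rw [esymm_one]
    exact IsHomogeneous.sum _ _ _ fun i _ => isHomogeneous_X K i
  lower_mem d f hf := by
    refine ⟨(mem_symS K n _).mpr fun e => ?_, ?_⟩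
    · rw [rename_lowering, (mem_symS K n _).mp hf.1 e]
    · have hf' : f.IsHomogeneous (d + 1) := hf.2
      rw [lowering_apply]
      refine Submodule.sum_mem _ fun i _ => Submodule.sub_mem _
        (Submodule.smul_mem _ _ (hf'.pderiv (i := i))) ?_
      cases d with
      | zero =>
        have h0 := (hf'.pderiv (i := i))
        obtain ⟨r, hr⟩ : ∃ r, pderiv i f = C r :=
          ⟨_, totalDegree_eq_zero_iff_eq_C.mp ((totalDegree_zero_iff_isHomogeneous _).mpr h0)⟩
        rw [hr, pderiv_C, mul_zero]
        exact zero_mem _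
      | succ d =>
        rw [add_comm]
        exact (isHomogeneous_X K i).mul ((hf'.pderiv (i := i)).pderiv (i := i))
  lower_zero f hf := by
    have h0 : f.IsHomogeneous 0 := hf.2
    rw [totalDegree_eq_zero_iff_eq_C.mp ((totalDegree_zero_iff_isHomogeneous _).mpr h0),
      lowering_apply]
    simp
  comm d f hf := by
    rw [LinearMap.mulLeft_apply, lowering_esymm_one_mul hf.2, LinearMap.mulLeft_apply,
      Nat.cast_sub (Nat.le_mul_of_pos_right n ha), Nat.cast_mul, mul_sub, mul_one]

theorem esymm_one_pow_mul (k : ℕ) (f : MvPolynomial (Fin n) K) :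
    (LinearMap.mulLeft K (esymm (Fin n) K 1) ^ k) f = esymm (Fin n) K 1 ^ k * f := by
  rw [LinearMap.pow_mulLeft, LinearMap.mulLeft_apply]

end SymmetricQuotient

section PowerSumIdeal

open MvPolynomial Module

variable (K : Type) [Field K] (n : ℕ)

/-- The sum of the conjugates of a polynomial under permutations of the variables. -/
noncomputable def symmetrize : MvPolynomial (Fin n) K →ₗ[K] ↥(symS K n) :=
  LinearMap.codRestrict (Subalgebra.toSubmodule (symS K n))
    (∑ e : Equiv.Perm (Fin n), (rename e).toLinearMap) fun f => by
      refine (mem_symS K n _).mpr fun e' => ?_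
      simp only [LinearMap.sum_apply, AlgHom.toLinearMap_apply, map_sum, rename_rename]
      exact Fintype.sum_equiv (Equiv.mulLeft e') _ _ fun e => rfl

/-- The ideal of `S` generated by the power sums of degrees `a, …, a + n - 1`. -/
noncomputable abbrev psumIdeal (a : ℕ) : Ideal ↥(symS K n) :=
  Ideal.span (Set.range fun j : Fin n => psumS K n (a + j))

variable {K n}

theorem coe_symmetrize (f : MvPolynomial (Fin n) K) :
    (symmetrize K n f : MvPolynomial (Fin n) K) = ∑ e : Equiv.Perm (Fin n), rename e f := by
  change (∑ e : Equiv.Perm (Fin n), (rename e).toLinearMap) f = _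
  simp [LinearMap.sum_apply]

theorem symmetrize_mul (s : ↥(symS K n)) (f : MvPolynomial (Fin n) K) :
    symmetrize K n (s * f) = s * symmetrize K n f := by
  apply Subtype.ext
  rw [MulMemClass.coe_mul, coe_symmetrize, coe_symmetrize, Finset.mul_sum]
  refine Finset.sum_congr rfl fun e _ => ?_
  rw [map_mul, (mem_symS K n _).mp s.2 e]

theorem symmetrize_coe (s : ↥(symS K n)) :
    symmetrize K n s = (n.factorial : K) • s := by
  apply Subtype.ext
  rw [coe_symmetrize, Finset.sum_congr rfl fun e _ => (mem_symS K n _).mp s.2 e]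
  simp [Fintype.card_perm, smul_eq_C_mul]

theorem symmetrize_rename (e : Equiv.Perm (Fin n)) (f : MvPolynomial (Fin n) K) :
    symmetrize K n (rename e f) = symmetrize K n f := by
  apply Subtype.ext
  rw [coe_symmetrize, coe_symmetrize]
  simp only [rename_rename]
  exact Fintype.sum_equiv (Equiv.mulRight e) _ _ fun _ => rfl

theorem psumS_mem_psumIdeal {a d : ℕ} (ha : 0 < a) (hd : a ≤ d) :
    psumS K n d ∈ psumIdeal K n a := by
  induction d using Nat.strong_induction_on with
  | _ d ih =>
    by_cases hlt : d < a + n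
    · obtain ⟨j, rfl⟩ := Nat.exists_eq_add_of_le hd
      exact Ideal.subset_span ⟨⟨j, by omega⟩, rfl⟩
    · have hzero : ∀ k, n < k → esymm (Fin n) K k = 0 := fun k hk => by
        rw [esymm, Finset.powersetCard_eq_empty.mpr (by simpa using hk), Finset.sum_empty]
      have hnewton : psumS K n d = -∑ p ∈ Finset.HasAntidiagonal.antidiagonal d with p.1 ∈ Set.Ioo 0 d,
          (-1) ^ p.1 * esymmS K n p.1 * psumS K n p.2 := by
        apply Subtype.ext
        have := psum_eq_mul_esymm_sub_sum (Fin n) K d (by omega)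
        rw [hzero d (by omega), mul_zero, zero_sub] at this
        simpa [psumS, esymmS] using this
      rw [hnewton]
      refine neg_mem (sum_mem fun p hp => ?_)
      simp only [Finset.mem_filter, Finset.HasAntidiagonal.mem_antidiagonal, Set.mem_Ioo] at hp
      by_cases hp1 : n < p.1
      · have : esymmS K n p.1 = 0 := Subtype.ext (hzero _ hp1)
        rw [this, mul_zero, zero_mul]
        exact zero_mem _
      · exact Ideal.mul_mem_left _ _ (ih p.2 (by omega) (by omega))

theorem coe_mem_powerSpan_of_mem_psumIdeal {a : ℕ} {s : ↥(symS K n)} (hs : s ∈ psumIdeal K n a) :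
    (s : MvPolynomial (Fin n) K) ∈ powerSpan K n a := by
  induction hs using Submodule.span_induction with
  | mem x hx =>
    obtain ⟨j, rfl⟩ := hx
    change psum (Fin n) K (a + j) ∈ _
    refine Submodule.sum_mem _ fun i _ => ?_
    rw [X_pow_eq_monomial]
    exact monomial_mem_powerSpan (i := i) (by simp) 1
  | zero => exact zero_mem _
  | add x y _ _ hx hy => exact add_mem hx hy
  | smul r x _ hx => exact mul_mem_powerSpan _ hx

/-- Multiplying the orbit sum of a monomial by a power sum. -/
theorem psumS_mul_symmetrize_monomial (b : ℕ) (m : Fin n →₀ ℕ) :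
    psumS K n b * symmetrize K n (monomial m 1) =
      ∑ k, symmetrize K n (monomial (m + Finsupp.single k b) 1) := by
  rw [← symmetrize_mul, ← map_sum]
  congr 1
  change psum (Fin n) K b * _ = _
  rw [psum, Finset.sum_mul]
  refine Finset.sum_congr rfl fun k _ => ?_
  rw [X_pow_eq_monomial, monomial_mul, one_mul, add_comm]

theorem symmetrize_monomial_mem [CharZero K] {a : ℕ} (ha : 0 < a) (m : Fin n →₀ ℕ) (i : Fin n)
    (hi : a ≤ m i) : symmetrize K n (monomial m 1) ∈ psumIdeal K n a := by
  classical
  induction hN : m.support.card using Nat.strong_induction_on generalizing m i with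
  | _ N ih =>
    set m' := m.erase i with hm'
    have him' : i ∉ m'.support := by simp [hm']
    have hsupp : m'.support.card < N := by
      rw [hm', Finsupp.support_erase, ← hN]
      exact Finset.card_erase_lt_of_mem (Finsupp.mem_support_iff.mpr (by omega))
    have hout : ∀ k ∉ m'.support, symmetrize K n (monomial (m' + Finsupp.single k (m i)) 1) =
        symmetrize K n (monomial m 1) := fun k hk => by
      rw [← symmetrize_rename (Equiv.swap i k) (monomial m 1), rename_monomial]
      congr 3
      have hmm : m = m' + Finsupp.single i (m i) := (Finsupp.erase_add_single i m).symm
      conv_rhs => rw [hmm]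
      rw [Finsupp.mapDomain_add, Finsupp.mapDomain_single, Equiv.swap_apply_left]
      congr 1
      ext j
      rw [Finsupp.mapDomain_equiv_apply, Equiv.symm_swap]
      rw [Finsupp.notMem_support_iff] at hk him'
      rcases eq_or_ne j i with rfl | hji
      · rw [Equiv.swap_apply_left, hk, him']
      · rcases eq_or_ne j k with rfl | hjk
        · rw [Equiv.swap_apply_right, hk, him']
        · rw [Equiv.swap_apply_of_ne_of_ne hji hjk]
    have hin : ∀ k ∈ m'.support,
        symmetrize K n (monomial (m' + Finsupp.single k (m i)) 1) ∈ psumIdeal K n a :=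
      fun k hk => by
        refine ih _ ?_ _ k (by simp; omega) rfl
        refine (Finset.card_le_card ?_).trans_lt hsupp
        refine Finsupp.support_add.trans (Finset.union_subset le_rfl ?_)
        exact Finsupp.support_single_subset.trans (Finset.singleton_subset_iff.mpr hk)
    have hprod := psumS_mul_symmetrize_monomial (K := K) (m i) m'
    rw [← Finset.sum_add_sum_compl m'.support,
      Finset.sum_congr rfl fun k hk => hout k (Finset.mem_compl.mp hk), Finset.sum_const,
      ← Nat.cast_smul_eq_nsmul K, ← sub_eq_iff_eq_add'] at hprod
    have hne : ((m'.supportᶜ.card : ℕ) : K) ≠ 0 :=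
      Nat.cast_ne_zero.mpr (Finset.card_ne_zero_of_mem (Finset.mem_compl.mpr him'))
    have hmem := sub_mem (Ideal.mul_mem_right (symmetrize K n (monomial m' 1)) _
      (psumS_mem_psumIdeal (K := K) (n := n) ha hi)) (sum_mem hin)
    rw [hprod] at hmem
    have := Submodule.smul_of_tower_mem (psumIdeal K n a) ((m'.supportᶜ.card : K)⁻¹) hmem
    rwa [inv_smul_smul₀ hne] at this

theorem mem_psumIdeal_iff [CharZero K] {a : ℕ} (ha : 0 < a) {s : ↥(symS K n)} :
    s ∈ psumIdeal K n a ↔ (s : MvPolynomial (Fin n) K) ∈ powerSpan K n a := by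
  refine ⟨coe_mem_powerSpan_of_mem_psumIdeal, fun hs => ?_⟩
  have hmem : symmetrize K n s ∈ psumIdeal K n a :=
    powerSpan_induction
      (N := ((psumIdeal K n a).restrictScalars K).comap (symmetrize K n))
      (fun m i hi => symmetrize_monomial_mem ha m i hi) hs
  rw [symmetrize_coe] at hmem
  have := Submodule.smul_of_tower_mem (psumIdeal K n a) ((n.factorial : K)⁻¹) hmem
  rwa [inv_smul_smul₀ (Nat.cast_ne_zero.mpr n.factorial_ne_zero)] at this

theorem mem_symQuotGrading_iff {J : Ideal ↥(symS K n)} {d : ℕ} {v : ↥(symS K n) ⧸ J} :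
    v ∈ symQuotGrading K n J d ↔ ∃ s : ↥(symS K n),
      (s : MvPolynomial (Fin n) K) ∈ symHomogeneous K n d ∧ Ideal.Quotient.mk J s = v := by
  constructor
  · rintro ⟨s, hs, rfl⟩
    exact ⟨s, ⟨s.2, hs⟩, rfl⟩
  · rintro ⟨s, hs, rfl⟩
    exact ⟨s, hs.2, rfl⟩

theorem gradedTop_symQuotGrading [CharZero K] {a : ℕ} (ha : 0 < a) :
    GradedTop K (A := ↥(symS K n) ⧸ psumIdeal K n a) (symQuotGrading K n (psumIdeal K n a)) (n * a - n) := by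
  constructor
  · let f : MvPolynomial (Fin n) K := ∏ i, X i ^ (a - 1)
    have hsym : f ∈ symS K n := (mem_symS K n _).mpr fun e => by
      simp only [f, map_prod, map_pow, rename_X]
      exact Equiv.prod_comp e fun i => (X i : MvPolynomial (Fin n) K) ^ (a - 1)
    have hhom : f.IsHomogeneous (n * a - n) := by
      have := IsHomogeneous.prod (R := K) Finset.univ (fun i : Fin n => X i ^ (a - 1)) _
        fun i _ => isHomogeneous_X_pow i (a - 1)
      simpa [Nat.mul_sub] using this
    have hmon : f = monomial (Finsupp.equivFunOnFinite.symm fun _ => a - 1) 1 := by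
      rw [monomial_eq, Finsupp.prod_fintype _ _ (by simp)]
      simp [f]
    intro hbot
    have hmem := (mem_symQuotGrading_iff (J := psumIdeal K n a)).mpr
      ⟨⟨f, hsym⟩, ⟨hsym, hhom⟩, rfl⟩
    rw [hbot, Submodule.mem_bot, Ideal.Quotient.eq_zero_iff_mem, mem_psumIdeal_iff ha] at hmem
    change f ∈ _ at hmem
    rw [hmon, powerSpan, monomial_mem_restrictSupport] at hmem
    obtain ⟨i, hi⟩ | h := hmem
    · simp at hi
      omega
    · exact one_ne_zero h
  · intro d hd
    rw [eq_bot_iff]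
    intro v hv
    obtain ⟨s, hs, rfl⟩ := mem_symQuotGrading_iff.mp hv
    rw [Submodule.mem_bot, Ideal.Quotient.eq_zero_iff_mem, mem_psumIdeal_iff ha]
    exact homogeneous_le_powerSpan ha hd hs.2

theorem isAlgSLElem_esymmS_one [CharZero K] {a : ℕ} (ha : 0 < a) :
    IsAlgSLElem K (A := ↥(symS K n) ⧸ psumIdeal K n a) (symQuotGrading K n (psumIdeal K n a)) (n * a - n)
      (Ideal.Quotient.mk _ (esymmS K n 1)) := by
  have hpair := isLefschetzPair_symHomogeneous (K := K) (n := n) ha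
  have hE : ∀ f ∈ powerSpan K n a,
      LinearMap.mulLeft K (esymm (Fin n) K 1) f ∈ powerSpan K n a :=
    fun f hf => mul_mem_powerSpan _ hf
  have hF : ∀ f ∈ powerSpan K n a, lowering K n a f ∈ powerSpan K n a :=
    fun f hf => lowering_mem_powerSpan hf
  refine ⟨mem_symQuotGrading_iff.mpr ⟨esymmS K n 1, ⟨(esymmS K n 1).2, ?_⟩, rfl⟩,
    fun d hd => ⟨fun v hv hv0 => ?_, fun w hw => ?_⟩⟩
  · change esymm (Fin n) K 1 ∈ _
    rw [esymm_one]
    exact IsHomogeneous.sum _ _ _ fun i _ => isHomogeneous_X K i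
  · obtain ⟨s, hs, rfl⟩ := mem_symQuotGrading_iff.mp hv
    rw [← map_pow, ← map_mul, Ideal.Quotient.eq_zero_iff_mem, mem_psumIdeal_iff ha] at hv0
    rw [Ideal.Quotient.eq_zero_iff_mem, mem_psumIdeal_iff ha]
    refine hpair.mem_of_raise_pow_mem hE hF hd hs ?_
    rw [esymm_one_pow_mul]
    exact hv0
  · obtain ⟨s, hs, rfl⟩ := mem_symQuotGrading_iff.mp hw
    obtain ⟨f, hf, hfs⟩ := hpair.exists_raise_pow_sub_mem hE hF
      (fun e he => inf_le_right.trans (homogeneous_le_powerSpan ha he)) hd hs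
    refine ⟨_, mem_symQuotGrading_iff.mpr ⟨⟨f, hf.1⟩, hf, rfl⟩, ?_⟩
    rw [← map_pow, ← map_mul, Ideal.Quotient.eq, mem_psumIdeal_iff ha]
    rw [esymm_one_pow_mul] at hfs
    exact hfs

end PowerSumIdeal

/-- Lemma 7.5. Let `K` be a field of characteristic zero and
`a` a positive integer.  The Artinian complete intersection
`B = K[e₁, …, e_n]/(p_a, p_{a+1}, …, p_{a+n-1})` (a quotient of the ring `S` of
symmetric polynomials with its induced non-standard grading, socle degree
`na - n`) has the SLP, and the image of `e₁` is a strong Lefschetz element. -/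
theorem statement_15 (K : Type) [Field K] [CharZero K] (n : ℕ) (hn : 0 < n)
    (a : ℕ) (ha : 0 < a) :
    GradedTop K
      (A := ↥(symS K n) ⧸ Ideal.span (Set.range fun j : Fin n => psumS K n (a + j)))
      (symQuotGrading K n (Ideal.span (Set.range fun j : Fin n => psumS K n (a + j))))
      (n * a - n) ∧
    IsAlgSLElem K
      (A := ↥(symS K n) ⧸ Ideal.span (Set.range fun j : Fin n => psumS K n (a + j)))
      (symQuotGrading K n (Ideal.span (Set.range fun j : Fin n => psumS K n (a + j))))
      (n * a - n)
      (Ideal.Quotient.mk _ (esymmS K n 1)) := by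
  exact ⟨gradedTop_symQuotGrading ha, isAlgSLElem_esymmS_one ha⟩
end
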